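/- For every θ ∈ [0, π], setting a = θ/π, one has 1 − Γ((a+1)/2) / ( Γ((1−a)/2) · Γ(a/2 + 1)² ) · H(a) ≥ 0.843 · (1 − cos θ)/2, where H(a) = Σ_{n=0}^∞ (a/2)_n ((a+1)/2)_n² / ( ((a/2)+1)_n² n! ). (Consequently the Sticky Brownian Motion rounding separates a pair of vertices at angle θ with probability at least 0.843 times its SDP contribution (1 − cos θ)/2.) -/

import Mathlib

open Real

/-- Pochhammer symbol (rising factorial): `(c)ₙ = c(c+1)⋯(c+n−1)`, with `(c)₀ = 1`. -/
noncomputable def poch (c : ℝ) (n : ℕ) : ℝ := ∏ k ∈ Finset.range n, (c + k)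

/-- The hypergeometric sum
`H(a) = Σ_{n=0}^∞ (a/2)_n ((a+1)/2)_n² / ( ((a/2)+1)_n² n! )`. -/
noncomputable def H (a : ℝ) : ℝ :=
  ∑' n : ℕ, poch (a / 2) n * (poch ((a + 1) / 2) n) ^ 2 /
    ((poch (a / 2 + 1) n) ^ 2 * (Nat.factorial n))

lemma poch_zero (c : ℝ) : poch c 0 = 1 := by simp [poch]

lemma poch_succ (c : ℝ) (n : ℕ) : poch c (n + 1) = poch c n * (c + n) := by
  simp [poch, Finset.prod_range_succ]

lemma poch_nonneg {c : ℝ} (hc : 0 ≤ c) (n : ℕ) : 0 ≤ poch c n :=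
  Finset.prod_nonneg fun k _ => by positivity

lemma poch_pos {c : ℝ} (hc : 0 < c) (n : ℕ) : 0 < poch c n :=
  Finset.prod_pos fun k _ => by positivity

/-- The summand of `H (2 * b)`. -/
noncomputable def hypTerm (b : ℝ) (n : ℕ) : ℝ :=
  poch b n * (poch (b + 1 / 2) n) ^ 2 / ((poch (b + 1) n) ^ 2 * (Nat.factorial n))

lemma hypTerm_nonneg {b : ℝ} (hb : 0 ≤ b) (n : ℕ) : 0 ≤ hypTerm b n := by
  have := poch_nonneg hb n
  unfold hypTerm
  positivity

lemma hypTerm_zero (b : ℝ) : hypTerm b 0 = 1 := by simp [hypTerm, poch_zero]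

lemma hypTerm_succ {b : ℝ} (hb : 0 ≤ b) (n : ℕ) :
    hypTerm b (n + 1) =
      hypTerm b n * ((b + n) * (b + 1 / 2 + n) ^ 2 / ((b + 1 + n) ^ 2 * (n + 1))) := by
  have h1 := (poch_pos (show 0 < b + 1 by linarith) n).ne'
  have h2 : (b + 1 + n) ≠ 0 := by positivity
  have h3 : ((n : ℝ) + 1) ≠ 0 := by positivity
  have h4 : (Nat.factorial n : ℝ) ≠ 0 := by positivity
  simp only [hypTerm, poch_succ, Nat.factorial_succ]
  push_cast
  field_simp

lemma H_eq_tsum_hypTerm (b : ℝ) : H (2 * b) = ∑' n, hypTerm b n := by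
  unfold H hypTerm
  rw [show 2 * b / 2 = b by ring, show (2 * b + 1) / 2 = b + 1 / 2 by ring]

/-- Telescoping majorant of the tail: `hypTerm b n ≤ u n - u (n + 1)` for `n ≥ 1`, where
`u n = hypTerm b n * (n + 9 / 10) / (1 - b)`. -/
lemma hypTerm_telescope {b : ℝ} (hb : 0 ≤ b) (hb' : b ≤ 1 / 2) (m : ℕ) :
    hypTerm b (m + 1) * (1 - b) + hypTerm b (m + 2) * (m + 2 + 9 / 10) ≤
      hypTerm b (m + 1) * (m + 1 + 9 / 10) := by
  rw [hypTerm_succ hb (m + 1)]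
  have h0 := hypTerm_nonneg hb (m + 1)
  push_cast
  have hm : (0 : ℝ) ≤ m := m.cast_nonneg
  generalize (m : ℝ) = x at *
  have hD : 0 < (b + 1 + (x + 1)) ^ 2 * (x + 1 + 1) := by positivity
  have key : (b + (x + 1)) * (b + 1 / 2 + (x + 1)) ^ 2 / ((b + 1 + (x + 1)) ^ 2 * (x + 1 + 1)) *
      (x + 2 + 9 / 10) ≤ x + 9 / 10 + b := by
    rw [div_mul_eq_mul_div, div_le_iff₀ hD]
    obtain ⟨e, rfl⟩ : ∃ e, b = 1 / 2 - e := ⟨1 / 2 - b, by ring⟩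
    have he : 0 ≤ e := by linarith
    have he' : e ≤ 1 / 2 := by linarith
    nlinarith [mul_nonneg hm he, mul_nonneg hm hm, mul_nonneg (mul_nonneg hm hm) he,
      mul_nonneg hb he, mul_nonneg hm (mul_nonneg hb he), mul_nonneg he (mul_nonneg hb he),
      mul_nonneg hb (mul_nonneg hb he), mul_nonneg (mul_nonneg hm hm) (mul_nonneg hb he),
      mul_nonneg (mul_nonneg hm hm) hb]
  nlinarith [mul_le_mul_of_nonneg_left key h0]

lemma H_le {b : ℝ} (hb : 0 ≤ b) (hb' : b ≤ 1 / 2) :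
    H (2 * b) ≤ 1 + 19 / 10 * b * (b + 1 / 2) ^ 2 / ((b + 1) ^ 2 * (1 - b)) := by
  have h1b : 0 < 1 - b := by linarith
  have ind : ∀ m : ℕ, ∑ k ∈ Finset.range (m + 1), hypTerm b k +
      hypTerm b (m + 1) * (m + 1 + 9 / 10) / (1 - b) ≤
      1 + hypTerm b 1 * (19 / 10) / (1 - b) := by
    intro m
    induction m with
    | zero => simp [hypTerm_zero]; norm_num
    | succ m ih =>
      refine le_trans ?_ ih
      rw [Finset.sum_range_succ _ (m + 1), add_assoc]
      refine add_le_add le_rfl ?_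
      rw [le_div_iff₀ h1b, add_mul, div_mul_cancel₀ _ h1b.ne']
      have := hypTerm_telescope hb hb' m
      push_cast
      linarith
  have h1 : hypTerm b 1 * (19 / 10) / (1 - b) =
      19 / 10 * b * (b + 1 / 2) ^ 2 / ((b + 1) ^ 2 * (1 - b)) := by
    rw [hypTerm_succ hb 0, hypTerm_zero]
    have : b + 1 ≠ 0 := by positivity
    field_simp
    simp
  rw [H_eq_tsum_hypTerm, ← h1]
  refine Real.tsum_le_of_sum_range_le (hypTerm_nonneg hb) fun n => ?_
  refine le_trans ?_ (ind n)
  rw [Finset.sum_range_succ]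
  have := hypTerm_nonneg hb n
  have := hypTerm_nonneg hb (n + 1)
  have : 0 ≤ hypTerm b (n + 1) * (n + 1 + 9 / 10) / (1 - b) := by positivity
  linarith

/-- The squared Gamma quotient `(Γ(x + 1/2) / Γ(x + 1))²`. -/
noncomputable def gammaQuot (x : ℝ) : ℝ := (Gamma (x + 1 / 2) / Gamma (x + 1)) ^ 2

lemma gammaQuot_eq_shift {x : ℝ} (hx : 0 ≤ x) :
    gammaQuot x = gammaQuot (x + 1) * ((x + 1) / (x + 1 / 2)) ^ 2 := by
  have h1 : Gamma (x + 1 + 1 / 2) = (x + 1 / 2) * Gamma (x + 1 / 2) := by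
    rw [← Gamma_add_one (by positivity)]; ring_nf
  have h2 : Gamma (x + 1 + 1) = (x + 1) * Gamma (x + 1) := Gamma_add_one (by positivity)
  have h3 : Gamma (x + 1) ≠ 0 := (Gamma_pos_of_pos (by linarith)).ne'
  have h4 : x + 1 / 2 ≠ 0 := by positivity
  have h5 : x + 1 ≠ 0 := by positivity
  unfold gammaQuot
  rw [h1, h2]
  field_simp

lemma gammaQuot_nonneg (x : ℝ) : 0 ≤ gammaQuot x := sq_nonneg _

lemma gammaQuot_le_inv {x : ℝ} (hx : 0 < x) : gammaQuot x ≤ 1 / x := by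
  have h := Real.Gamma_mul_add_mul_le_rpow_Gamma_mul_rpow_Gamma (s := x) (t := x + 1)
    (a := 1 / 2) (b := 1 / 2) hx (by linarith) (by norm_num) (by norm_num) (by norm_num)
  rw [show 1 / 2 * x + 1 / 2 * (x + 1) = x + 1 / 2 by ring, ← Real.sqrt_eq_rpow,
    ← Real.sqrt_eq_rpow] at h
  have h1 : 0 < Gamma x := Gamma_pos_of_pos hx
  have h2 : 0 < Gamma (x + 1 / 2) := Gamma_pos_of_pos (by linarith)
  have h3 : Gamma (x + 1) = x * Gamma x := Gamma_add_one hx.ne'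
  have h4 : 0 < Gamma (x + 1) := Gamma_pos_of_pos (by linarith)
  have h5 : Gamma (x + 1 / 2) ^ 2 ≤ Gamma x * Gamma (x + 1) := by
    calc _ ≤ (√(Gamma x) * √(Gamma (x + 1))) ^ 2 := by gcongr
      _ = _ := by rw [mul_pow, Real.sq_sqrt h1.le, Real.sq_sqrt h4.le]
  unfold gammaQuot
  rw [div_pow, div_le_div_iff₀ (by positivity) hx]
  calc _ ≤ Gamma x * Gamma (x + 1) * x := by gcongr
    _ = _ := by rw [h3]; ring

/-- A sharpened Wallis-type bound. -/
lemma gammaQuot_mul_le_one {x : ℝ} (hx : 0 ≤ x) : gammaQuot x * (x + 1 / 4) ≤ 1 := by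
  have mono : ∀ y : ℝ, 0 ≤ y →
      gammaQuot y * (y + 1 / 4) ≤ gammaQuot (y + 1) * (y + 1 + 1 / 4) := by
    intro y hy
    rw [gammaQuot_eq_shift hy, mul_assoc]
    refine mul_le_mul_of_nonneg_left ?_ (gammaQuot_nonneg _)
    rw [div_pow, div_mul_eq_mul_div, div_le_iff₀ (by positivity)]
    nlinarith
  have hn : ∀ n : ℕ, gammaQuot x * (x + 1 / 4) ≤ gammaQuot (x + n) * (x + n + 1 / 4) := by
    intro n
    induction n with
    | zero => simp
    | succ n ih =>
      refine ih.trans ?_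
      have := mono (x + n) (by positivity)
      push_cast
      rwa [← add_assoc]
  refine le_of_forall_pos_le_add fun ε hε => ?_
  obtain ⟨n, hne⟩ := exists_nat_gt (1 / ε)
  have hn0 : (0 : ℝ) < n := lt_trans (by positivity) hne
  have hxn : 0 < x + n := by positivity
  have h1 : 1 < ε * (x + n) := by
    rw [div_lt_iff₀ hε] at hne
    nlinarith
  refine (hn n).trans ?_
  calc gammaQuot (x + n) * (x + n + 1 / 4) ≤ 1 / (x + n) * (x + n + 1 / 4) := by
        gcongr; exact gammaQuot_le_inv hxn
    _ ≤ 1 + ε := by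
        rw [div_mul_eq_mul_div, div_le_iff₀ hxn]; nlinarith

lemma gammaQuot_le {x : ℝ} (hx : 0 ≤ x) :
    gammaQuot x ≤ ((x + 1) / (x + 1 / 2)) ^ 2 / (x + 5 / 4) := by
  rw [gammaQuot_eq_shift hx, div_eq_inv_mul (_ ^ 2)]
  gcongr
  rw [← one_div, le_div_iff₀ (by positivity)]
  have := gammaQuot_mul_le_one (x := x + 1) (by positivity)
  linarith

lemma Gamma_mul_Gamma_le {s x h : ℝ} (hs : 0 < s) (hx : 0 ≤ x) (hh : 0 < h) :
    Gamma (s + x) * Gamma (s + h) ≤ Gamma s * Gamma (s + x + h) := by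
  have hxh : 0 < x + h := by positivity
  have hA : 0 < Gamma s := Gamma_pos_of_pos hs
  have hB : 0 < Gamma (s + x + h) := Gamma_pos_of_pos (by positivity)
  rcases hx.eq_or_lt with rfl | hx
  · simp
  have h1 := Real.Gamma_mul_add_mul_le_rpow_Gamma_mul_rpow_Gamma (s := s) (t := s + x + h)
    (a := h / (x + h)) (b := x / (x + h)) hs (by positivity) (by positivity) (by positivity)
    (by field_simp; ring)
  have h2 := Real.Gamma_mul_add_mul_le_rpow_Gamma_mul_rpow_Gamma (s := s) (t := s + x + h)
    (a := x / (x + h)) (b := h / (x + h)) hs (by positivity) (by positivity) (by positivity)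
    (by field_simp)
  rw [show h / (x + h) * s + x / (x + h) * (s + x + h) = s + x by field_simp; ring] at h1
  rw [show x / (x + h) * s + h / (x + h) * (s + x + h) = s + h by field_simp; ring] at h2
  have hsum : h / (x + h) + x / (x + h) = 1 := by field_simp; ring
  calc _ ≤ _ := mul_le_mul h1 h2 (Gamma_pos_of_pos (by positivity)).le (by positivity)
    _ = (Gamma s ^ (h / (x + h)) * Gamma s ^ (x / (x + h))) *
        (Gamma (s + x + h) ^ (h / (x + h)) * Gamma (s + x + h) ^ (x / (x + h))) := by ring
    _ = _ := by rw [← rpow_add hA, ← rpow_add hB, hsum, rpow_one, rpow_one]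

lemma gammaQuot_zero : gammaQuot 0 = π := by
  simp only [gammaQuot, zero_add, Gamma_one, div_one]
  rw [Gamma_one_half_eq, Real.sq_sqrt pi_pos.le]

lemma gammaQuot_le_pi_mul {x : ℝ} (hx : 0 ≤ x) :
    gammaQuot x ≤ π * ((x + 1) / (1 + 2 * x)) ^ 2 := by
  have h1 : gammaQuot (x + 1) ≤ gammaQuot 1 := by
    have h := Gamma_mul_Gamma_le (s := 1 + 1 / 2) (x := x) (h := 1 / 2)
      (by norm_num) hx (by norm_num)
    have hg : 0 < Gamma (1 + 1 / 2) := Gamma_pos_of_pos (by norm_num)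
    have hg' : 0 < Gamma (x + 1 + 1 / 2) := Gamma_pos_of_pos (by positivity)
    have hg2 : 0 < Gamma (x + 1 + 1) := Gamma_pos_of_pos (by positivity)
    have hg3 : 0 < Gamma (1 + 1) := Gamma_pos_of_pos (by norm_num)
    unfold gammaQuot
    refine pow_le_pow_left₀ (by positivity) ?_ 2
    rw [div_le_div_iff₀ hg2 hg3]
    calc _ = Gamma (1 + 1 / 2 + x) * Gamma (1 + 1 / 2 + 1 / 2) := by
          rw [show x + 1 + 1 / 2 = 1 + 1 / 2 + x by ring,
            show (1 : ℝ) + 1 / 2 + 1 / 2 = 1 + 1 by norm_num]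
      _ ≤ _ := h
      _ = _ := by rw [show 1 + 1 / 2 + x + 1 / 2 = x + 1 + 1 by ring]
  have h0 := gammaQuot_eq_shift (x := 0) le_rfl
  rw [gammaQuot_zero, zero_add] at h0
  have h2 : gammaQuot 1 = π / 4 := by linarith
  rw [gammaQuot_eq_shift hx]
  calc _ ≤ π / 4 * ((x + 1) / (x + 1 / 2)) ^ 2 := by rw [← h2]; gcongr
    _ = _ := by
      have : x + 1 / 2 ≠ 0 := by positivity
      have : 1 + 2 * x ≠ 0 := by positivity
      field_simp
      ring

lemma H_nonneg {b : ℝ} (hb : 0 ≤ b) : 0 ≤ H (2 * b) := by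
  rw [H_eq_tsum_hypTerm]
  exact tsum_nonneg (hypTerm_nonneg hb)

lemma gammaQuot_mul_H_le_pi_mul {b : ℝ} (hb : 0 ≤ b) (hb' : b ≤ 1 / 2) :
    gammaQuot b * H (2 * b) ≤ π * (((b + 1) / (1 + 2 * b)) ^ 2 + 19 / 40 * b / (1 - b)) := by
  calc _ ≤ _ := mul_le_mul (gammaQuot_le_pi_mul hb) (H_le hb hb') (H_nonneg hb) (by positivity)
    _ = _ := by
      have : 1 - b ≠ 0 := by linarith
      have : b + 1 ≠ 0 := by positivity
      have : 1 + 2 * b ≠ 0 := by positivity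
      field_simp
      ring

lemma gammaQuot_mul_H_le {b : ℝ} (hb : 0 ≤ b) (hb' : b ≤ 1 / 2) :
    gammaQuot b * H (2 * b) ≤
      (((b + 1) / (b + 1 / 2)) ^ 2 + 19 / 10 * b / (1 - b)) / (b + 5 / 4) := by
  calc _ ≤ _ := mul_le_mul (gammaQuot_le hb) (H_le hb hb') (H_nonneg hb) (by positivity)
    _ = _ := by
      have : 1 - b ≠ 0 := by linarith
      have : b + 1 ≠ 0 := by positivity
      have : b + 1 / 2 ≠ 0 := by positivity
      have : b + 5 / 4 ≠ 0 := by positivity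
      field_simp

/-- Clearing denominators in `gammaQuot_mul_H_le`. -/
lemma gammaQuot_mul_H_le_of_poly {b M : ℝ} (hb : 0 ≤ b) (hb' : b ≤ 1 / 2)
    (h : (b + 1) ^ 2 * (1 - b) + 19 / 10 * b * (b + 1 / 2) ^ 2 ≤
      M * 3.1415 * ((b + 5 / 4) * (b + 1 / 2) ^ 2 * (1 - b))) (hM : 0 ≤ M) :
    gammaQuot b * H (2 * b) ≤ π * M := by
  have h1b : 0 < 1 - b := by linarith
  have hpi := Real.pi_gt_d4
  have h3 : M * 3.1415 ≤ π * M := by nlinarith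
  refine (gammaQuot_mul_H_le hb hb').trans (le_trans ?_ h3)
  rw [div_pow, div_add_div _ _ (by positivity) h1b.ne', div_div, div_le_iff₀ (by positivity)]
  linarith

lemma gammaQuot_mul_H_le_quadratic {b : ℝ} (hb : 0 ≤ b) (hb' : b ≤ 0.28) :
    gammaQuot b * H (2 * b) ≤ π * (1 - 3.39 * b ^ 2) := by
  rcases le_total b 0.175 with h | h
  · refine (gammaQuot_mul_H_le_pi_mul hb (by linarith)).trans ?_
    refine mul_le_mul_of_nonneg_left ?_ pi_pos.le
    have h1b : 0 < 1 - b := by linarith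
    rw [div_pow, div_add_div _ _ (by positivity) h1b.ne', div_le_iff₀ (by positivity)]
    have hz : 0 ≤ 0.175 - b := by linarith
    nlinarith [mul_nonneg hb hz, mul_nonneg hb (mul_nonneg hb hz),
      mul_nonneg hb (mul_nonneg hb (mul_nonneg hb hz)),
      mul_nonneg (mul_nonneg hb hb) (mul_nonneg hb (mul_nonneg hb hz))]
  · refine gammaQuot_mul_H_le_of_poly hb (by linarith) ?_ (by nlinarith)
    have hy : 0 ≤ b - 0.175 := by linarith
    have hz : 0 ≤ 0.28 - b := by linarith
    have hyz := mul_nonneg hy hz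
    nlinarith [hyz, mul_nonneg hyz hy, mul_nonneg hyz hz, mul_nonneg hyz hyz,
      mul_nonneg hyz (mul_nonneg hy hy), mul_nonneg (mul_nonneg hyz hyz) hy,
      mul_nonneg (mul_nonneg hyz hyz) hz, mul_nonneg (mul_nonneg hyz hyz) hyz]

lemma gammaQuot_mul_H_le_mid {b : ℝ} (hb : 0.28 ≤ b) (hb' : b ≤ 0.43) :
    gammaQuot b * H (2 * b) ≤ π * 0.727 := by
  refine gammaQuot_mul_H_le_of_poly (by linarith) (by linarith) ?_ (by norm_num)
  have hyz := mul_nonneg (sub_nonneg.2 hb) (sub_nonneg.2 hb')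
  nlinarith [mul_nonneg hyz (sub_nonneg.2 hb), mul_nonneg hyz (sub_nonneg.2 hb'),
    mul_nonneg hyz hyz]

lemma gammaQuot_mul_H_le_right {b : ℝ} (hb : 0.43 ≤ b) (hb' : b ≤ 0.5) :
    gammaQuot b * H (2 * b) ≤ π * 0.78 := by
  refine gammaQuot_mul_H_le_of_poly (by linarith) (by linarith) ?_ (by norm_num)
  have hyz := mul_nonneg (sub_nonneg.2 hb) (sub_nonneg.2 hb')
  nlinarith [mul_nonneg hyz (sub_nonneg.2 hb), mul_nonneg hyz (sub_nonneg.2 hb'),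
    mul_nonneg hyz hyz]

lemma Gamma_factor_eq {b : ℝ} (hb : 0 ≤ b) :
    Gamma (b + 1 / 2) / (Gamma (1 / 2 - b) * Gamma (b + 1) ^ 2) =
      cos (π * b) * (gammaQuot b / π) := by
  have h := Real.Gamma_mul_Gamma_one_sub (b + 1 / 2)
  rw [show 1 - (b + 1 / 2) = 1 / 2 - b by ring,
    show π * (b + 1 / 2) = π * b + π / 2 by ring, Real.sin_add_pi_div_two] at h
  have h1 : Gamma (b + 1 / 2) ≠ 0 := (Gamma_pos_of_pos (by positivity)).ne'
  have h2 : Gamma (1 / 2 - b) = π / cos (π * b) / Gamma (b + 1 / 2) := by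
    rw [← h, mul_div_cancel_left₀ _ h1]
  rw [h2, gammaQuot]
  simp only [div_eq_mul_inv, mul_inv, inv_inv, mul_pow, inv_pow]
  ring

lemma cos_mul_le {b K : ℝ} (hb : 0 ≤ b) (hb' : b ≤ 1 / 2)
    (h1 : b ≤ 0.28 → K ≤ 1 - 3.39 * b ^ 2) (h2 : 0.28 ≤ b → b ≤ 0.43 → K ≤ 0.727)
    (h3 : 0.43 ≤ b → K ≤ 0.78) :
    cos (π * b) * K ≤ 0.157 + 0.843 * cos (π * b) ^ 2 := by
  have hpi := Real.pi_lt_d4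
  have hpi0 := Real.pi_pos
  have hc0 : 0 ≤ cos (π * b) :=
    Real.cos_nonneg_of_neg_pi_div_two_le_of_le (by nlinarith) (by nlinarith)
  have hc1 : cos (π * b) ≤ 1 := Real.cos_le_one _
  have hquad : 1 - (π * b) ^ 2 / 2 ≤ cos (π * b) := Real.one_sub_sq_div_two_le_cos
  have hlin : cos (π * b) ≤ π * (1 / 2 - b) := by
    have := Real.sin_le (x := π / 2 - π * b) (by nlinarith)
    rw [Real.sin_pi_div_two_sub] at this
    linarith
  generalize cos (π * b) = c at *
  rcases le_total b 0.28 with h | h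
  · have hK := mul_le_mul_of_nonneg_left (h1 h) hc0
    have hpi2 : π ^ 2 ≤ 9.8702 := by nlinarith
    have hd : 1 - c ≤ 4.9351 * b ^ 2 := by nlinarith [sq_nonneg b]
    nlinarith [mul_nonneg (sub_nonneg.2 hc1) (sub_nonneg.2 hc1), mul_le_mul_of_nonneg_left hd hc0,
      mul_nonneg hc0 (sq_nonneg b)]
  rcases le_total b 0.43 with h' | h'
  · have hK := mul_le_mul_of_nonneg_left (h2 h h') hc0
    nlinarith [sq_nonneg (c - 0.4315)]
  · have hK := mul_le_mul_of_nonneg_left (h3 h') hc0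
    have : c ≤ 0.22 := by nlinarith
    nlinarith

theorem stmt2 (θ : ℝ) (hθ : θ ∈ Set.Icc (0 : ℝ) π) (a : ℝ) (ha : a = θ / π) :
    1 - Real.Gamma ((a + 1) / 2) /
          (Real.Gamma ((1 - a) / 2) * (Real.Gamma (a / 2 + 1)) ^ 2) * H a ≥
      0.843 * ((1 - Real.cos θ) / 2) := by
  obtain ⟨hθ0, hθ1⟩ := hθ
  have hpi := Real.pi_pos
  obtain ⟨b, rfl⟩ : ∃ b, a = 2 * b := ⟨a / 2, by ring⟩
  have hθb : θ = 2 * (π * b) := by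
    rw [eq_div_iff hpi.ne'] at ha
    linarith
  have hb : 0 ≤ b := by
    by_contra! hneg
    nlinarith
  have hb' : b ≤ 1 / 2 := by
    by_contra! hlt
    nlinarith
  have hK : ∀ M : ℝ, gammaQuot b * H (2 * b) ≤ π * M → gammaQuot b / π * H (2 * b) ≤ M := by
    intro M hM
    rw [div_mul_eq_mul_div, div_le_iff₀ hpi]
    linarith
  have key := cos_mul_le hb hb' (K := gammaQuot b / π * H (2 * b))
    (fun h => hK _ (gammaQuot_mul_H_le_quadratic hb h))
    (fun h h' => hK _ (gammaQuot_mul_H_le_mid h h'))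
    (fun h => hK _ (gammaQuot_mul_H_le_right h (by linarith)))
  rw [show (2 * b + 1) / 2 = b + 1 / 2 by ring, show (1 - 2 * b) / 2 = 1 / 2 - b by ring,
    show 2 * b / 2 = b by ring, Gamma_factor_eq hb, hθb, Real.cos_two_mul]
  linarith
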